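/- Every finite simple subcubic graph (every vertex has degree at most 3) with odd-girth at least 7, i.e., containing no cycle of length 3 and no cycle of length 5, admits a (7,2)-edge-coloring; in particular, its circular chromatic index is at most 7/2. -/

import Mathlib

/-- A (7,2)-edge-coloring of a simple graph `G`: a function from the edge set of `G`
to `ZMod 7` such that any two distinct edges sharing a common vertex receive colors
whose difference lies in `{2,3,4,5}`. -/
def IsCircEdgeColoring72 {V : Type*} (G : SimpleGraph V) (c : G.edgeSet → ZMod 7) : Prop :=
  ∀ e f : G.edgeSet, e ≠ f → (∃ v : V, v ∈ (e : Sym2 V) ∧ v ∈ (f : Sym2 V)) →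
    c e - c f ∈ ({2, 3, 4, 5} : Set (ZMod 7))

/-- The six-letter word `a b c b̄ c̄ ā`. -/
def windowWord (a b c : Bool) : Fin 6 → Bool
  | 0 => a | 1 => b | 2 => c | 3 => !b | 4 => !c | 5 => !a

/-- No word `a b c b̄ c̄ ā` has the prescribed signs along the pairs `{i, p i}`. -/
def WindowObstructed (p : Fin 6 → Fin 6) (s : Fin 6 → Bool) : Prop :=
  ∀ a b c, ∃ i, (windowWord a b c i ^^ windowWord a b c (p i)) ≠ s i

instance (p : Fin 6 → Fin 6) (s : Fin 6 → Bool) : Decidable (WindowObstructed p s) :=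
  inferInstanceAs (Decidable (∀ _, _))

/-- The position `i` of a window is responsible for it when it is matched to position `j` with
sign `s`. For a given displacement `j - i` and sign there is at most one such `i`. -/
def Responsible (s : Bool) (i j : Fin 6) : Prop :=
  if s then
    (i.val, j.val) ∈ [(0, 1), (0, 2), (0, 4), (1, 4), (5, 4), (5, 3), (5, 2), (5, 1)]
  else
    (i.val, j.val) ∈ [(1, 2), (1, 3), (1, 4), (1, 5), (0, 5), (4, 3), (4, 2)]

instance (s : Bool) (i j : Fin 6) : Decidable (Responsible s i j) := by
  unfold Responsible; infer_instance

/-- The pairing `p` of a window, seen from the window one step further. -/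
def shiftUp (p : Fin 6 → Fin 6) (i : Fin 6) : Fin 6 :=
  if i = 5 ∨ p (i + 1) = 0 then i else p (i + 1) - 1

/-- The pairing `p` of a window, seen from the window one step before. -/
def shiftDown (p : Fin 6 → Fin 6) (i : Fin 6) : Fin 6 :=
  if i = 0 ∨ p (i - 1) = 5 then i else p (i - 1) + 1

/-- The signs of a window, seen from the window one step further. -/
def signUp (p : Fin 6 → Fin 6) (s : Fin 6 → Bool) (i : Fin 6) : Bool :=
  if i = 5 ∨ p (i + 1) = 0 then false else s (i + 1)

/-- The signs of a window, seen from the window one step before. -/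
def signDown (p : Fin 6 → Fin 6) (s : Fin 6 → Bool) (i : Fin 6) : Bool :=
  if i = 0 ∨ p (i - 1) = 5 then false else s (i - 1)

/-- The sextuple with the given entries. -/
def tuple6 {α : Type*} (x0 x1 x2 x3 x4 x5 : α) : Fin 6 → α
  | 0 => x0 | 1 => x1 | 2 => x2 | 3 => x3 | 4 => x4 | 5 => x5

/-- An obstructed window contains a responsible position, or it is perfectly paired and one of
the neighbouring windows is not obstructed. -/
def ObstructionAccounted (p : Fin 6 → Fin 6) (s : Fin 6 → Bool) : Prop :=
  WindowObstructed p s → (∃ i, Responsible (s i) i (p i)) ∨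
    ((∀ i, p i ≠ i) ∧ ¬ (WindowObstructed (shiftUp p) (signUp p s) ∧
      WindowObstructed (shiftDown p) (signDown p s)))

instance (p : Fin 6 → Fin 6) (s : Fin 6 → Bool) : Decidable (ObstructionAccounted p s) := by
  unfold ObstructionAccounted; infer_instance

/-- The pairing `p` of the positions 0, ..., 5 on a cycle of length seven, seen from the window
starting at `k`. -/
def cyclicShift (p : Fin 6 → Fin 6) (k : Fin 7) (i : Fin 6) : Fin 6 :=
  if h : (k + i.castSucc).val < 6 then
    if h' : ((p ((k + i.castSucc).castLT h)).castSucc - k).val < 6 then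
      ((p ((k + i.castSucc).castLT h)).castSucc - k).castLT h'
    else i
  else i

/-- The signs of the positions 0, ..., 5 on a cycle of length seven, seen from the window starting
at `k`. -/
def cyclicSign (s : Fin 6 → Bool) (k : Fin 7) (i : Fin 6) : Bool :=
  if h : (k + i.castSucc).val < 6 then s ((k + i.castSucc).castLT h) else false

set_option synthInstance.maxSize 4000 in
set_option synthInstance.maxHeartbeats 400000 in
set_option maxRecDepth 10000 in
theorem window_tuple6 :
    ∀ p0 : Fin 6,
    ∀ p1 : Fin 6, (p0 = 1 ↔ p1 = 0) →
    ∀ p2 : Fin 6, (p0 = 2 ↔ p2 = 0) → (p1 = 2 ↔ p2 = 1) →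
    ∀ p3 : Fin 6, (p0 = 3 ↔ p3 = 0) → (p1 = 3 ↔ p3 = 1) → (p2 = 3 ↔ p3 = 2) →
    ∀ p4 : Fin 6, (p0 = 4 ↔ p4 = 0) → (p1 = 4 ↔ p4 = 1) → (p2 = 4 ↔ p4 = 2) → (p3 = 4 ↔ p4 = 3) →
    ∀ p5 : Fin 6, (p0 = 5 ↔ p5 = 0) → (p1 = 5 ↔ p5 = 1) → (p2 = 5 ↔ p5 = 2) → (p3 = 5 ↔ p5 = 3) →
      (p4 = 5 ↔ p5 = 4) →
    (∀ i, tuple6 p0 p1 p2 p3 p4 p5 (tuple6 p0 p1 p2 p3 p4 p5 i) = i) →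
    ∀ s0 : Bool, (p0 = 0 → s0 = false) →
    ∀ s1 : Bool, (p1 = 1 → s1 = false) → (p1 = 0 → s1 = s0) →
    ∀ s2 : Bool, (p2 = 2 → s2 = false) → (p2 = 0 → s2 = s0) → (p2 = 1 → s2 = s1) →
    ∀ s3 : Bool, (p3 = 3 → s3 = false) → (p3 = 0 → s3 = s0) → (p3 = 1 → s3 = s1) → (p3 = 2 →
      s3 = s2) →
    ∀ s4 : Bool, (p4 = 4 → s4 = false) → (p4 = 0 → s4 = s0) → (p4 = 1 → s4 = s1) → (p4 = 2 →
      s4 = s2) → (p4 = 3 → s4 = s3) →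
    ∀ s5 : Bool, (p5 = 5 → s5 = false) → (p5 = 0 → s5 = s0) → (p5 = 1 → s5 = s1) → (p5 = 2 →
      s5 = s2) → (p5 = 3 → s5 = s3) → (p5 = 4 → s5 = s4) →
    ObstructionAccounted (tuple6 p0 p1 p2 p3 p4 p5) (tuple6 s0 s1 s2 s3 s4 s5) ∧
    ∃ k, ¬ WindowObstructed (cyclicShift (tuple6 p0 p1 p2 p3 p4 p5) k)
      (cyclicSign (tuple6 s0 s1 s2 s3 s4 s5) k) := by
  decide +kernel

theorem obstructionAccounted_and_exists_not_windowObstructed (p : Fin 6 → Fin 6)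
    (s : Fin 6 → Bool) (hp : ∀ i, p (p i) = i)
    (hs : ∀ i, s (p i) = s i) (hfix : ∀ i, p i = i → s i = false) :
    ObstructionAccounted p s ∧
      ∃ k, ¬ WindowObstructed (cyclicShift p k) (cyclicSign s k) := by
  have e {α : Type} (f : Fin 6 → α) : f = tuple6 (f 0) (f 1) (f 2) (f 3) (f 4) (f 5) := by
    funext i; fin_cases i <;> rfl
  have hiff (i j : Fin 6) : p i = j ↔ p j = i :=
    ⟨fun h => h ▸ hp i, fun h => h ▸ hp j⟩
  have hs' (i j : Fin 6) (h : p i = j) : s i = s j := h ▸ (hs i).symm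
  rw [e p, e s]
  apply window_tuple6 <;> first | exact hiff _ _ | exact hs' _ _ | exact hfix _ | skip
  rw [← e p]; exact hp

/-- The word `a b c b̄ c̄ ā`, written from `k` onwards, has the sign `s x` along each pair
`{x, q x}` contained in the window starting at `k`. -/
def WindowFits {n : ℕ} (q : ZMod n → ZMod n) (s : ZMod n → Bool) (k : ZMod n) (a b c : Bool) :
    Prop :=
  ∀ i j : Fin 6, q (k + i.val) = k + j.val →
    (windowWord a b c i ^^ windowWord a b c j) = s (k + i.val)

theorem natCast_eq_natCast_of_lt {n a b : ℕ} (ha : a < n) (hb : b < n) :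
    ((a : ZMod n) = b) ↔ a = b := by
  rw [ZMod.natCast_eq_natCast_iff', Nat.mod_eq_of_lt ha, Nat.mod_eq_of_lt hb]

theorem responsible_unique : ∀ (s : Bool) (i j i' j' : Fin 6), Responsible s i j →
    Responsible s i' j' → (j.val + i'.val = j'.val + i.val → i = i') ∧
      ∀ m, 9 ≤ m → j.val + i'.val ≠ j'.val + i.val + m := by
  have h : ∀ (s : Bool) (i j i' j' : Fin 6), Responsible s i j → Responsible s i' j' →
      (j.val + i'.val = j'.val + i.val → i = i') ∧ j.val + i'.val < j'.val + i.val + 9 := by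
    decide +kernel
  intro s i j i' j' h1 h2
  obtain ⟨h3, h4⟩ := h s i j i' j' h1 h2
  exact ⟨h3, fun m hm => by omega⟩

theorem Responsible.ne : ∀ {s : Bool} {i j : Fin 6}, Responsible s i j → i ≠ j := by
  decide +kernel

/-- A matched slot is responsible for at most one window. -/
theorem responsible_window_unique {n : ℕ} (hn : 9 ≤ n) {q : ZMod n → ZMod n} {s : ZMod n → Bool}
    {x k k' : ZMod n} {i j i' j' : Fin 6} (hx : x = k + i.val) (hq : q x = k + j.val)
    (h : Responsible (s x) i j) (hx' : x = k' + i'.val) (hq' : q x = k' + j'.val)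
    (h' : Responsible (s x) i' j') : k = k' := by
  have e : ((j.val + i'.val : ℕ) : ZMod n) = (j'.val + i.val : ℕ) := by
    push_cast
    linear_combination hx - hq - hx' + hq'
  obtain ⟨u1, u2⟩ := responsible_unique _ i j i' j' h h'
  obtain ⟨-, u3⟩ := responsible_unique _ i' j' i j h' h
  suffices j.val + i'.val = j'.val + i.val by
    obtain rfl := u1 this
    exact add_right_cancel (hx.symm.trans hx')
  rw [ZMod.natCast_eq_natCast_iff] at e
  rcases le_total (j.val + i'.val) (j'.val + i.val) with hle | hle
  · obtain ⟨t, ht⟩ := (Nat.modEq_iff_dvd' hle).1 e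
    rcases Nat.eq_zero_or_pos t with rfl | ht0
    · omega
    · have := Nat.le_mul_of_pos_right n ht0
      have := u3 (n * t) (by omega)
      omega
  · obtain ⟨t, ht⟩ := (Nat.modEq_iff_dvd' hle).1 e.symm
    rcases Nat.eq_zero_or_pos t with rfl | ht0
    · omega
    · have := Nat.le_mul_of_pos_right n ht0
      have := u2 (n * t) (by omega)
      omega

open Classical in
/-- The pairing `q` restricted to the window starting at `k`. -/
noncomputable def localPartner {n : ℕ} (q : ZMod n → ZMod n) (k : ZMod n) (i : Fin 6) : Fin 6 :=
  if h : ∃ j : Fin 6, q (k + i.val) = k + j.val then h.choose else i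

section
variable {n : ℕ} (hn : 7 ≤ n) {q : ZMod n → ZMod n} {s : ZMod n → Bool} {k : ZMod n}
include hn

theorem window_injective {i j : Fin 6} (h : k + (i.val : ZMod n) = k + j.val) : i = j :=
  Fin.ext ((natCast_eq_natCast_of_lt (by omega) (by omega)).1 (add_left_cancel h))

theorem localPartner_eq {i j : Fin 6} (h : q (k + i.val) = k + j.val) :
    localPartner q k i = j := by
  have h' : ∃ j : Fin 6, q (k + i.val) = k + j.val := ⟨j, h⟩
  rw [localPartner, dif_pos h']
  exact window_injective hn (h'.choose_spec.symm.trans h)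

omit hn in
theorem apply_localPartner {i : Fin 6} (h : localPartner q k i ≠ i) :
    q (k + i.val) = k + (localPartner q k i).val := by
  by_cases h' : ∃ j : Fin 6, q (k + i.val) = k + j.val
  · rw [localPartner, dif_pos h']
    exact h'.choose_spec
  · rw [localPartner, dif_neg h'] at h
    exact absurd rfl h

/-- The signs `s` restricted to the window starting at `k`. -/
noncomputable def localSign (q : ZMod n → ZMod n) (s : ZMod n → Bool) (k : ZMod n) (i : Fin 6) :
    Bool :=
  if localPartner q k i = i then false else s (k + i.val)

theorem localPartner_localPartner (hq : ∀ x, q (q x) = x) (i : Fin 6) :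
    localPartner q k (localPartner q k i) = i := by
  by_cases h : localPartner q k i = i
  · rw [h, h]
  · apply localPartner_eq hn
    rw [← apply_localPartner h, hq]

theorem localSign_localPartner (hq : ∀ x, q (q x) = x) (hs : ∀ x, s (q x) = s x) (i : Fin 6) :
    localSign q s k (localPartner q k i) = localSign q s k i := by
  by_cases h : localPartner q k i = i
  · rw [h]
  · rw [localSign, localSign, localPartner_localPartner hn hq, if_neg h, if_neg (Ne.symm h),
      ← apply_localPartner h, hs]

omit hn in
theorem windowObstructed_of_agree (hfix : ∀ x, q x = x → s x = false)
    (h : ∀ a b c, ¬ WindowFits q s k a b c) {p' : Fin 6 → Fin 6} {s' : Fin 6 → Bool}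
    (hp' : ∀ i j, i ≠ j → q (k + i.val) = k + j.val → p' i = j ∧ s' i = s (k + i.val)) :
    WindowObstructed p' s' := by
  intro a b c
  by_contra! hc
  apply h a b c
  intro i j hij
  by_cases e : i = j
  · subst e
    rw [hfix _ hij, Bool.xor_self]
  · obtain ⟨h1, h2⟩ := hp' i j e hij
    rw [← h1, ← h2, hc i]

theorem exists_responsible (hq : ∀ x, q (q x) = x) (hs : ∀ x, s (q x) = s x)
    (hfix : ∀ x, q x = x → s x = false) (h : ∀ k a b c, ¬ WindowFits q s k a b c) (k : ZMod n) :
    ∃ i j : Fin 6, q (k + i.val) = k + j.val ∧ Responsible (s (k + i.val)) i j := by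
  have h0 : WindowObstructed (localPartner q k) (localSign q s k) := by
    refine windowObstructed_of_agree hfix (h k) fun i j hij e => ?_
    have := localPartner_eq hn e
    refine ⟨this, ?_⟩
    rw [localSign, if_neg (this ▸ hij.symm)]
  have hacc := (obstructionAccounted_and_exists_not_windowObstructed (localPartner q k)
    (localSign q s k) (localPartner_localPartner hn hq) (localSign_localPartner hn hq hs)
    (fun i hi => if_pos hi)).1 h0
  rcases hacc with ⟨i, hi⟩ | ⟨hperf, hnot⟩
  · have hne : localPartner q k i ≠ i := hi.ne.symm
    refine ⟨i, _, apply_localPartner hne, ?_⟩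
    rwa [localSign, if_neg hne] at hi
  · exfalso
    have hap (i) := apply_localPartner (hperf i)
    refine hnot ⟨windowObstructed_of_agree hfix (h (k + 1)) fun i j hij e => ?_,
      windowObstructed_of_agree hfix (h (k - 1)) fun i j hij e => ?_⟩
    · have e1 (i : Fin 6) : k + 1 + (i.val : ZMod n) = k + ((i.val + 1 : ℕ) : ZMod n) := by
        push_cast; ring
      by_cases hi : i = 5
      · exfalso
        have hj : j.val + 1 < 6 := by have := Fin.val_ne_of_ne hij; omega
        rw [e1, e1] at e
        have e2 := hap ⟨j.val + 1, hj⟩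
        simp only at e2
        rw [← e, hq] at e2
        have e3 := (natCast_eq_natCast_of_lt (n := n) (by omega) (by omega)).1 (add_left_cancel e2)
        omega
      · have hv : (i + 1).val = i.val + 1 := by omega
        rw [e1, e1, ← hv, hap (i + 1)] at e
        have e3 := (natCast_eq_natCast_of_lt (n := n) (by omega) (by omega)).1 (add_left_cancel e)
        have hz : localPartner q k (i + 1) ≠ 0 := by
          intro hz; rw [hz] at e3; simp at e3
        refine ⟨?_, ?_⟩
        · rw [shiftUp, if_neg (by tauto)]; omega
        · rw [signUp, if_neg (by tauto), localSign, if_neg (hperf _), e1, hv]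
    · have e1 (i : Fin 6) (hi : i ≠ 0) :
          k - 1 + (i.val : ZMod n) = k + ((i - 1 : Fin 6).val : ZMod n) := by
        have hv : i.val = (i - 1).val + 1 := by omega
        rw [hv]; push_cast; ring
      by_cases hi : i = 0
      · exfalso
        rw [hi] at e
        rw [e1 j (fun hj => hij (hi.trans hj.symm))] at e
        have e2 := hap (j - 1)
        rw [← e, hq] at e2
        have e4 : ((0 : ℕ) : ZMod n) = ((localPartner q k (j - 1)).val + 1 : ℕ) := by
          push_cast
          simp only [Fin.val_zero, Nat.cast_zero] at e2
          linear_combination e2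
        have e3 := (natCast_eq_natCast_of_lt (n := n) (by omega) (by omega)).1 e4
        omega
      · rw [e1 i hi, hap (i - 1)] at e
        have e4 : (((localPartner q k (i - 1)).val + 1 : ℕ) : ZMod n) = (j.val : ℕ) := by
          push_cast; linear_combination e
        have e3 := (natCast_eq_natCast_of_lt (n := n) (by omega) (by omega)).1 e4
        have hz : localPartner q k (i - 1) ≠ 5 := by
          intro hz; rw [hz] at e3; omega
        refine ⟨?_, ?_⟩
        · rw [shiftDown, if_neg (by tauto)]; omega
        · rw [signDown, if_neg (by tauto), localSign, if_neg (hperf _), e1 i hi]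

end

theorem exists_windowFits_seven {q : ZMod 7 → ZMod 7} {s : ZMod 7 → Bool}
    (hq : ∀ x, q (q x) = x) (hs : ∀ x, s (q x) = s x) (hfix : ∀ x, q x = x → s x = false)
    {x : ZMod 7} (hx : q x = x) : ∃ k a b c, WindowFits q s k a b c := by
  by_contra! hcon
  obtain ⟨k, hk⟩ := (obstructionAccounted_and_exists_not_windowObstructed (localPartner q (x + 1))
    (localSign q s (x + 1)) (localPartner_localPartner le_rfl hq)
    (localSign_localPartner le_rfl hq hs) fun i hi => if_pos hi).2
  have hval (m : Fin 7) (hm : ¬ m.val < 6) : x + 1 + (m.val : ZMod 7) = x := by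
    rw [show m.val = 6 by omega, show ((6 : ℕ) : ZMod 7) = -1 by decide, add_neg_cancel_right]
  have hpos (i : Fin 6) : x + 1 + (k.val : ZMod 7) + (i.val : ZMod 7) =
      x + 1 + ((k + i.castSucc).val : ZMod 7) := by
    rw [Fin.val_add, ZMod.natCast_mod, Nat.cast_add, Fin.val_castSucc, add_assoc]
  refine hk (windowObstructed_of_agree hfix (hcon (x + 1 + (k.val : ZMod 7))) fun i j hij e => ?_)
  by_cases hi : (k + i.castSucc).val < 6
  · by_cases hj : (k + j.castSucc).val < 6
    · have hp : localPartner q (x + 1) ((k + i.castSucc).castLT hi) =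
          (k + j.castSucc).castLT hj := by
        rw [hpos, hpos] at e
        exact localPartner_eq le_rfl e
      have hne : (k + j.castSucc).castLT hj ≠ (k + i.castSucc).castLT hi := fun h =>
        have h' : k + j.castSucc = k + i.castSucc := by
          simpa only [Fin.castSucc_castLT] using congrArg Fin.castSucc h
        hij (Fin.castSucc_injective _ (add_left_cancel h')).symm
      rw [cyclicShift, cyclicSign, dif_pos hi, dif_pos hi, localSign, hp, if_neg hne, hpos]
      simp
    · have hxj := (hpos j).trans (hval _ hj)
      refine absurd (window_injective le_rfl (k := x + 1 + (k.val : ZMod 7)) ?_) hij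
      rw [← hq (x + 1 + _ + _), e, hxj, hx]
  · have hxi := (hpos i).trans (hval _ hi)
    refine absurd (window_injective le_rfl (k := x + 1 + (k.val : ZMod 7)) ?_) hij
    rw [← e, hxi, hx]

theorem exists_windowFits {n : ℕ} (hodd : Odd n) (hn : 7 ≤ n) {q : ZMod n → ZMod n}
    {s : ZMod n → Bool} (hq : ∀ x, q (q x) = x) (hs : ∀ x, s (q x) = s x)
    (hfix : ∀ x, q x = x → s x = false) : ∃ k a b c, WindowFits q s k a b c := by
  have : NeZero n := ⟨by omega⟩
  obtain ⟨x, hx⟩ := Equiv.Perm.exists_fixed_point_of_prime (p := 2) (n := 1)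
    (σ := (⟨q, q, hq, hq⟩ : Equiv.Perm (ZMod n)))
    (by rw [ZMod.card]; exact hodd.not_two_dvd_nat) (by ext x; simp [pow_two, hq])
  by_cases h7 : n = 7
  · subst h7
    exact exists_windowFits_seven hq hs hfix hx
  have hn9 : 9 ≤ n := by
    obtain ⟨m, rfl⟩ := hodd; omega
  by_contra! hcon
  choose i j hij hres using exists_responsible hn hq hs hfix hcon
  have hinj : Function.Injective fun k : ZMod n => k + ((i k).val : ZMod n) := by
    intro k k' hk
    simp only at hk
    exact responsible_window_unique hn9 (s := s) rfl (hij k) (hres k) hk (hk ▸ hij k')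
      (hk ▸ hres k')
  obtain ⟨k, rfl⟩ := Finite.surjective_of_injective hinj x
  have := hij k
  simp only [Equiv.coe_fn_mk] at hx
  rw [hx] at this
  exact (hres k).ne (window_injective hn this)

/-- A word on an odd cycle of length at least 7 can be changed, by flipping unions of orbits of a
given involution, to a word containing a window `a b c b̄ c̄ ā`. -/
theorem exists_window_of_involution {n : ℕ} (hodd : Odd n) (hn : 7 ≤ n) {q : ZMod n → ZMod n}
    (hq : ∀ x, q (q x) = x) (u : ZMod n → Bool) :
    ∃ w : ZMod n → Bool, (∀ x, (w (q x) ^^ u (q x)) = (w x ^^ u x)) ∧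
      ∃ k, w (k + 5) = !w k ∧ w (k + 3) = !w (k + 1) ∧ w (k + 4) = !w (k + 2) := by
  classical
  obtain ⟨k, a, b, c, h⟩ := exists_windowFits hodd hn (s := fun x => u x ^^ u (q x)) hq
    (fun x => by rw [hq, Bool.xor_comm]) (fun x hx => by simp only [hx, Bool.xor_self])
  set W := windowWord a b c with hW
  let w : ZMod n → Bool := fun x =>
    if h : ∃ i : Fin 6, x = k + i.val then W h.choose
    else if h : ∃ i : Fin 6, q x = k + i.val then W h.choose ^^ (u x ^^ u (q x)) else u x
  have w1 (i : Fin 6) : w (k + i.val) = W i := by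
    have h : ∃ j : Fin 6, k + (i.val : ZMod n) = k + j.val := ⟨i, rfl⟩
    simp only [w, dif_pos h]
    rw [← window_injective hn h.choose_spec]
  have w2 (x) (hx : ¬ ∃ i : Fin 6, x = k + i.val) (i : Fin 6) (hi : q x = k + i.val) :
      w x = (W i ^^ (u x ^^ u (q x))) := by
    have h : ∃ i : Fin 6, q x = k + i.val := ⟨i, hi⟩
    simp only [w, dif_neg hx, dif_pos h]
    rw [← window_injective hn (hi.symm.trans h.choose_spec)]
  refine ⟨w, fun x => ?_, k, ?_⟩
  · by_cases hx : ∃ i : Fin 6, x = k + i.val <;> by_cases hx' : ∃ i : Fin 6, q x = k + i.val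
    · obtain ⟨i, rfl⟩ := hx
      obtain ⟨j, hj⟩ := hx'
      have := h i j hj
      rw [w1, hj, w1]
      simp only [hj, ← hW] at this
      revert this
      generalize W i = A, W j = B, u (k + i.val) = C, u (k + j.val) = D
      revert A B C D; decide
    · obtain ⟨i, rfl⟩ := hx
      rw [w1, w2 _ hx' i (hq _), hq]
      generalize W i = A, u (k + i.val) = C, u (q (k + i.val)) = D
      revert A C D; decide
    · obtain ⟨j, hj⟩ := hx'
      rw [w2 _ hx j hj, hj, w1]
      generalize W j = A, u x = C, u _ = D
      revert A C D; decide
    · simp only [w, hq, dif_neg hx, dif_neg hx', Bool.xor_self]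
  · have h0 := w1 0
    have h1 := w1 1
    have h2 := w1 2
    have h3 := w1 3
    have h4 := w1 4
    have h5 := w1 5
    simp [hW, windowWord] at h0 h1 h2 h3 h4 h5
    simp [h0, h1, h2, h3, h4, h5]

/-- The word `w` on the cycle `ZMod n` reads `a b c b̄ c̄ ā` from `k` onwards. -/
def HasWindow {n : ℕ} (w : ZMod n → Bool) (k : ZMod n) : Prop :=
  w (k + 5) = !w k ∧ w (k + 3) = !w (k + 1) ∧ w (k + 4) = !w (k + 2)

section
open Equiv.Perm

variable {V : Type*} {S T : Equiv.Perm V} (hS : S * S = 1) (hT : T * T = 1)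
include hS hT

theorem involution_apply_zpow {s : V} (hs : T s = s) (i : ℤ) :
    T (((T * S) ^ i) s) = ((T * S) ^ (-i)) s := by
  have h1 : T * (T * S) * T⁻¹ = (T * S)⁻¹ := by
    rw [← mul_assoc, hT, one_mul, mul_inv_rev, inv_eq_of_mul_eq_one_right hS]
  have h2 : T * (T * S) ^ i * T⁻¹ = (T * S) ^ (-i) := by
    rw [← conj_zpow, h1, inv_zpow, zpow_neg]
  have hs' : T⁻¹ s = s := by rw [inv_eq_iff_eq, hs]
  rw [← h2, mul_apply, mul_apply, hs']

theorem SameCycle.involution_left {s v : V} (hs : T s = s) (h : SameCycle (T * S) s v) :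
    SameCycle (T * S) s (T v) := by
  obtain ⟨i, rfl⟩ := h
  exact ⟨-i, (involution_apply_zpow hS hT hs i).symm⟩

theorem SameCycle.involution_right {s v : V} (hs : T s = s) (h : SameCycle (T * S) s v) :
    SameCycle (T * S) s (S v) := by
  have : S v = T ((T * S) v) := by
    rw [← mul_apply, ← mul_assoc, hT, one_mul]
  rw [this]
  exact SameCycle.involution_left hS hT hs (h.trans (sameCycle_apply_right.2 (SameCycle.refl _ _)))

/-- A cycle of the product of two involutions contains at most two fixed points of one of them. -/
theorem SameCycle.fixed_points {x y z : V} (hx : T x = x) (hy : T y = y) (hz : T z = z)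
    (hxy : SameCycle (T * S) x y) (hxz : SameCycle (T * S) x z) : y = x ∨ z = x ∨ y = z := by
  obtain ⟨i, rfl⟩ := hxy
  obtain ⟨j, rfl⟩ := hxz
  let H : AddSubgroup ℤ :=
    { carrier := {t | ((T * S) ^ t) x = x}
      zero_mem' := by simp
      add_mem' := fun {a b} ha hb => by
        simp only [Set.mem_ofPred_eq] at *
        rw [zpow_add, mul_apply, hb, ha]
      neg_mem' := fun {a} ha => by
        simp only [Set.mem_ofPred_eq] at *
        rw [zpow_neg, inv_eq_iff_eq, ha] }
  have hH (t : ℤ) : t ∈ H ↔ ((T * S) ^ t) x = x := Iff.rfl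
  have key (t : ℤ) (ht : T (((T * S) ^ t) x) = ((T * S) ^ t) x) : 2 * t ∈ H := by
    rw [involution_apply_zpow hS hT hx] at ht
    rw [hH, two_mul, zpow_add, mul_apply, ← ht, ← mul_apply, ← zpow_add]
    simp
  obtain ⟨d, hd⟩ := Int.subgroup_cyclic H
  have hmem (t : ℤ) : t ∈ H ↔ ∃ a : ℤ, t = a * d := by
    rw [hd, AddSubgroup.mem_closure_singleton]
    simp [eq_comm]
  obtain ⟨a, ha⟩ := (hmem _).1 (key i hy)
  obtain ⟨b, hb⟩ := (hmem _).1 (key j hz)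
  have hdiff (h : i - j ∈ H) : ((T * S) ^ i) x = ((T * S) ^ j) x := by
    have : i = j + (i - j) := by ring
    rw [this, zpow_add, mul_apply, (hH _).1 h]
  rcases Int.even_or_odd' a with ⟨a', rfl | rfl⟩
  · left
    exact (hH i).1 ((hmem i).2 ⟨a', by linarith⟩)
  rcases Int.even_or_odd' b with ⟨b', rfl | rfl⟩
  · right; left
    exact (hH j).1 ((hmem j).2 ⟨b', by linarith⟩)
  · right; right
    exact hdiff ((hmem _).2 ⟨a' - b', by linarith⟩)

/-- A map constant on the orbits of `S` can be flipped on orbits of `⟨S, T⟩` in order to acquire a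
window on a given odd cycle of fixed points of `T`. -/
theorem exists_flip_hasWindow {n : ℕ} (hodd : Odd n) (hn : 7 ≤ n) {c : ZMod n → V}
    (hc : Function.Injective c) (hfix : ∀ x, T (c x) = c x) {m : V → Bool}
    (hm : ∀ v, m (S v) = m v) :
    ∃ m' : V → Bool, (∀ v, m' (S v) = m' v) ∧ (∀ v, (m' (T v) ^^ m' v) = (m (T v) ^^ m v)) ∧
      ∃ k, HasWindow (m' ∘ c) k := by
  classical
  let q : ZMod n → ZMod n := fun x =>
    if h : ∃ y, y ≠ x ∧ SameCycle (T * S) (c x) (c y) then h.choose else x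
  have q_eq {x y} (hne : y ≠ x) (h : SameCycle (T * S) (c x) (c y)) : q x = y := by
    have h' : ∃ y, y ≠ x ∧ SameCycle (T * S) (c x) (c y) := ⟨y, hne, h⟩
    simp only [q, dif_pos h']
    rcases SameCycle.fixed_points hS hT (hfix _) (hfix _) (hfix _) h'.choose_spec.2 h
      with h1 | h1 | h1
    · exact absurd (hc h1) h'.choose_spec.1
    · exact absurd (hc h1) hne
    · exact hc h1
  have q_inv (x) : q (q x) = x := by
    by_cases h : ∃ y, y ≠ x ∧ SameCycle (T * S) (c x) (c y)
    · obtain ⟨y, h1, h2⟩ := h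
      rw [q_eq h1 h2, q_eq h1.symm h2.symm]
    · have : q x = x := by simp only [q, dif_neg h]
      rw [this, this]
  obtain ⟨w, hw, k, hk⟩ := exists_window_of_involution hodd hn q_inv (m ∘ c)
  let P : V → Prop := fun v => ∃ x, (w x ^^ m (c x)) = true ∧ SameCycle (T * S) (c x) v
  have PT (v) : P (T v) ↔ P v := by
    have h1 (v) (h : P v) : P (T v) := by
      obtain ⟨x, hx, h⟩ := h
      exact ⟨x, hx, SameCycle.involution_left hS hT (hfix x) h⟩
    refine ⟨fun h => ?_, h1 v⟩
    have := h1 _ h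
    rwa [← mul_apply, hT] at this
  have PS (v) : P (S v) ↔ P v := by
    have h1 (v) (h : P v) : P (S v) := by
      obtain ⟨x, hx, h⟩ := h
      exact ⟨x, hx, SameCycle.involution_right hS hT (hfix x) h⟩
    refine ⟨fun h => ?_, h1 v⟩
    have := h1 _ h
    rwa [← mul_apply, hS] at this
  have Pc (x) : P (c x) ↔ (w x ^^ m (c x)) = true := by
    refine ⟨fun ⟨y, hy, h⟩ => ?_, fun h => ⟨x, h, SameCycle.refl _ _⟩⟩
    by_cases hxy : x = y
    · rwa [hxy]
    · have := hw y
      rw [q_eq hxy h] at this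
      exact this.trans hy
  have hmc (x) : (m (c x) ^^ decide (P (c x))) = w x := by
    simp only [Pc]
    generalize m (c x) = A, w x = B
    revert A B; decide
  refine ⟨fun v => m v ^^ decide (P v), fun v => ?_, fun v => ?_, k, ?_⟩
  · simp only [PS, hm]
  · simp only [PT]
    generalize m (T v) = A, m v = B, decide (P v) = C
    revert A B C; decide
  · simpa only [HasWindow, Function.comp_apply, hmc] using hk

end

theorem exists_involution_swap {V : Type*} {T : Equiv.Perm V} (hT : T * T = 1) {x y : V}
    (hx : T x = x) (hy : T y = y) :
    ∃ T' : Equiv.Perm V, T' * T' = 1 ∧ T' x = y ∧ T' y = x ∧ ∀ v, v ≠ x → v ≠ y → T' v = T v := by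
  classical
  refine ⟨T * Equiv.swap x y, ?_, by simp [hy], by simp [hx], fun v h1 h2 => by
    simp [Equiv.swap_apply_of_ne_of_ne h1 h2]⟩
  have : T * Equiv.swap x y = Equiv.swap x y * T := by
    rw [Equiv.mul_swap_eq_swap_mul, hx, hy]
  rw [← mul_assoc, this, mul_assoc (Equiv.swap x y), hT, mul_one, Equiv.swap_mul_self]

/-- Given an involution `σ` on a type containing disjoint odd cycles of length at least 7, there is
a `σ`-invariant Boolean map with a window on each cycle. -/
theorem exists_invariant_hasWindow {V ι : Type*} [Finite ι] {σ : V → V} (hσ : ∀ v, σ (σ v) = v)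
    {n : ι → ℕ} (hodd : ∀ i, Odd (n i)) (hn : ∀ i, 7 ≤ n i) (c : ∀ i, ZMod (n i) → V)
    (hc : ∀ i, Function.Injective (c i)) (hdisj : ∀ i j x y, c i x = c j y → i = j) :
    ∃ m : V → Bool, (∀ v, m (σ v) = m v) ∧ ∀ i, ∃ k, HasWindow (m ∘ c i) k := by
  classical
  have := Fintype.ofFinite ι
  suffices H : ∀ s : Finset ι, ∃ (T : Equiv.Perm V) (m : V → Bool), T * T = 1 ∧
      (∀ v, T v ≠ v → ∃ i ∈ s, ∃ x, v = c i x) ∧ (∀ v, m (σ v) = m v) ∧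
      (∀ v, T v ≠ v → m (T v) = !m v) ∧
      ∀ i ∈ s, ∃ k, T (c i k) = c i (k + 5) ∧ T (c i (k + 1)) = c i (k + 3) ∧
        T (c i (k + 2)) = c i (k + 4) by
    obtain ⟨T, m, -, -, hm, hT, hw⟩ := H Finset.univ
    refine ⟨m, hm, fun i => ?_⟩
    obtain ⟨k, h5, h3, h4⟩ := hw i (Finset.mem_univ i)
    have hne (a b : ℕ) (ha : a < 7) (hb : b < 7) (hab : a ≠ b) :
        c i (k + (a : ZMod (n i))) ≠ c i (k + (b : ZMod (n i))) := by
      intro h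
      have := hn i
      exact hab ((natCast_eq_natCast_of_lt (n := n i) (by omega) (by omega)).1
        (add_left_cancel (hc i h)))
    refine ⟨k, ?_, ?_, ?_⟩
    · have := hne 5 0 (by omega) (by omega) (by omega)
      simp only [Nat.cast_ofNat, Nat.cast_zero, add_zero] at this
      rw [← h5] at this
      simp only [Function.comp_apply, ← h5, hT _ this]
    · have := hne 3 1 (by omega) (by omega) (by omega)
      simp only [Nat.cast_ofNat, Nat.cast_one] at this
      rw [← h3] at this
      simp only [Function.comp_apply, ← h3, hT _ this]
    · have := hne 4 2 (by omega) (by omega) (by omega)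
      simp only [Nat.cast_ofNat] at this
      rw [← h4] at this
      simp only [Function.comp_apply, ← h4, hT _ this]
  let S : Equiv.Perm V := ⟨σ, σ, hσ, hσ⟩
  have hS : S * S = 1 := by ext v; exact hσ v
  intro s
  induction s using Finset.induction_on with
  | empty => exact ⟨1, fun _ => true, by simp, by simp, by simp, by simp, by simp⟩
  | insert j s hj ih =>
    obtain ⟨T, m, hT, hsupp, hm, hanti, hwin⟩ := ih
    have hfix (x) : T (c j x) = c j x := by
      by_contra h
      obtain ⟨i, hi, y, hy⟩ := hsupp _ h
      exact hj (hdisj _ _ _ _ hy ▸ hi)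
    obtain ⟨m', hm', hflip, k, hk⟩ :=
      exists_flip_hasWindow (S := S) hS hT (hodd j) (hn j) (hc j) hfix hm
    have hne (a b : ℕ) (ha : a < 7) (hb : b < 7) (hab : a ≠ b) :
        c j (k + (a : ZMod (n j))) ≠ c j (k + (b : ZMod (n j))) := by
      intro h
      have := hn j
      exact hab ((natCast_eq_natCast_of_lt (n := n j) (by omega) (by omega)).1
        (add_left_cancel (hc j h)))
    have h12 := hne 1 2 (by omega) (by omega) (by omega)
    have h13 := hne 1 3 (by omega) (by omega) (by omega)
    have h14 := hne 1 4 (by omega) (by omega) (by omega)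
    have h15 := hne 1 5 (by omega) (by omega) (by omega)
    have h23 := hne 2 3 (by omega) (by omega) (by omega)
    have h24 := hne 2 4 (by omega) (by omega) (by omega)
    have h25 := hne 2 5 (by omega) (by omega) (by omega)
    have h34 := hne 3 4 (by omega) (by omega) (by omega)
    have h35 := hne 3 5 (by omega) (by omega) (by omega)
    have h45 := hne 4 5 (by omega) (by omega) (by omega)
    have h01 := hne 0 1 (by omega) (by omega) (by omega)
    have h02 := hne 0 2 (by omega) (by omega) (by omega)
    have h03 := hne 0 3 (by omega) (by omega) (by omega)
    have h04 := hne 0 4 (by omega) (by omega) (by omega)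
    have h05 := hne 0 5 (by omega) (by omega) (by omega)
    obtain ⟨hk5, hk3, hk4⟩ := hk
    have f0 := hfix (k + ((0 : ℕ) : ZMod (n j)))
    have f1 := hfix (k + ((1 : ℕ) : ZMod (n j)))
    have f2 := hfix (k + ((2 : ℕ) : ZMod (n j)))
    have f3 := hfix (k + ((3 : ℕ) : ZMod (n j)))
    have f4 := hfix (k + ((4 : ℕ) : ZMod (n j)))
    have f5 := hfix (k + ((5 : ℕ) : ZMod (n j)))
    simp only [Nat.cast_ofNat, Nat.cast_zero, Nat.cast_one, add_zero] at *
    simp only [Function.comp_apply] at hk5 hk3 hk4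
    obtain ⟨A, hA, A0, A5, A'⟩ := exists_involution_swap hT f0 f5
    obtain ⟨B, hB, B1, B3, B'⟩ := exists_involution_swap hA
      ((A' _ h01.symm h15).trans f1) ((A' _ h03.symm h35).trans f3)
    obtain ⟨C, hC, C2, C4, C'⟩ := exists_involution_swap hB
      ((B' _ h12.symm h23).trans ((A' _ h02.symm h25).trans f2))
      ((B' _ h14.symm h34.symm).trans ((A' _ h04.symm h45).trans f4))
    have C0 := (C' _ h02 h04).trans ((B' _ h01 h03).trans A0)
    have C1 := (C' _ h12 h14).trans B1
    have C3 := (C' _ h23.symm h34).trans B3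
    have C5 := (C' _ h25.symm h45.symm).trans ((B' _ h15.symm h35.symm).trans A5)
    have hcase (v : V) : (∃ x, v = c j x ∧ m' (C v) = !m' v) ∨ C v = T v := by
      by_cases v0 : v = c j k
      · exact .inl ⟨_, v0, by rw [v0, C0, hk5]⟩
      by_cases v1 : v = c j (k + 1)
      · exact .inl ⟨_, v1, by rw [v1, C1, hk3]⟩
      by_cases v2 : v = c j (k + 2)
      · exact .inl ⟨_, v2, by rw [v2, C2, hk4]⟩
      by_cases v3 : v = c j (k + 3)
      · exact .inl ⟨_, v3, by rw [v3, C3, hk3, Bool.not_not]⟩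
      by_cases v4 : v = c j (k + 4)
      · exact .inl ⟨_, v4, by rw [v4, C4, hk4, Bool.not_not]⟩
      by_cases v5 : v = c j (k + 5)
      · exact .inl ⟨_, v5, by rw [v5, C5, hk5, Bool.not_not]⟩
      exact .inr ((C' v v2 v4).trans ((B' v v1 v3).trans (A' v v0 v5)))
    refine ⟨C, m', hC, fun v hv => ?_, hm', fun v hv => ?_, fun i hi => ?_⟩
    · rcases hcase v with ⟨x, hx, -⟩ | h
      · exact ⟨j, Finset.mem_insert_self _ _, x, hx⟩
      · obtain ⟨i, hi, hx⟩ := hsupp v (h ▸ hv)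
        exact ⟨i, Finset.mem_insert_of_mem hi, hx⟩
    · rcases hcase v with ⟨x, -, hx⟩ | h
      · exact hx
      · have h1 := hanti v (h ▸ hv)
        have h2 := hflip v
        rw [h, h1] at *
        revert h2
        generalize m' (T v) = A, m' v = B, m v = C
        revert A B C; decide
    · rcases Finset.mem_insert.1 hi with rfl | his
      · exact ⟨k, C0, C1, C2⟩
      · obtain ⟨l, hl⟩ := hwin i his
        have hT' (x) : C (c i x) = T (c i x) := by
          have hij (y) : c i x ≠ c j y := fun h => hj (hdisj _ _ _ _ h ▸ his)
          exact (C' _ (hij _) (hij _)).trans ((B' _ (hij _) (hij _)).trans (A' _ (hij _) (hij _)))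
        exact ⟨l, by simpa only [hT'] using hl⟩

/-- The colors `x` and `y` are at circular distance at least two. -/
def Far (x y : ZMod 7) : Prop := x - y ∈ ({2, 3, 4, 5} : Finset (ZMod 7))

instance (x y : ZMod 7) : Decidable (Far x y) := by unfold Far; infer_instance

theorem Far.symm : ∀ {x y : ZMod 7}, Far x y → Far y x := by decide

/-- The color `0` or `1` of a matching edge. -/
def matchingColor (b : Bool) : ZMod 7 := if b then 1 else 0

theorem ZMod.val_add_one_cases {n : ℕ} [NeZero n] (i : ZMod n) :
    (i + 1).val = i.val + 1 ∨ (i.val + 1 = n ∧ (i + 1).val = 0) := by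
  have h : i + 1 = ((i.val + 1 : ℕ) : ZMod n) := by simp
  have hlt := i.val_lt
  rw [h, ZMod.val_natCast]
  rcases Nat.lt_or_ge (i.val + 1) n with h' | h'
  · left; exact Nat.mod_eq_of_lt h'
  · right
    have : i.val + 1 = n := by omega
    exact ⟨this, by rw [this, Nat.mod_self]⟩

/-- The cyclic sequence of vertices of a cycle in a graph in which all degrees are 0 or 2. -/
theorem SimpleGraph.IsCycles.exists_parametrization {W : Type*} [Finite W] {F : SimpleGraph W}
    (hF : F.IsCycles) {v u : W} (huv : F.Adj v u) :
    ∃ n, 3 ≤ n ∧ ∃ f : ZMod n → W, Function.Injective f ∧ (∀ i, F.Adj (f i) (f (i + 1))) ∧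
      (∀ w, F.connectedComponentMk w = F.connectedComponentMk v ↔ ∃ i, w = f i) ∧
      ∀ i w, F.Adj (f i) w → w = f (i + 1) ∨ w = f (i - 1) := by
  obtain ⟨p, hp, hverts⟩ := hF.exists_cycle_toSubgraph_verts_eq_connectedComponentSupp
    (c := F.connectedComponentMk v) (v := v) rfl ⟨u, huv⟩
  have h3 := hp.three_le_length
  have : NeZero p.length := ⟨by omega⟩
  have hinj : Function.Injective fun i : ZMod p.length => p.getVert i.val := by
    intro i j hij
    have hi := i.val_lt
    have hj := j.val_lt
    exact ZMod.val_injective _ (hp.getVert_injOn' (by simp; omega) (by simp; omega) hij)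
  have hadj (i : ZMod p.length) : F.Adj (p.getVert i.val) (p.getVert (i + 1).val) := by
    have h := p.adj_getVert_succ i.val_lt
    rcases ZMod.val_add_one_cases i with h1 | ⟨h1, h2⟩
    · rwa [h1]
    · rw [h1, p.getVert_length] at h
      rwa [h2, p.getVert_zero]
  refine ⟨p.length, h3, fun i => p.getVert i.val, hinj, hadj, fun w => ?_, fun i w hw => ?_⟩
  · have : w ∈ p.toSubgraph.verts ↔ F.connectedComponentMk w = F.connectedComponentMk v := by
      rw [hverts]; rfl
    rw [← this, p.mem_verts_toSubgraph, Walk.mem_support_iff_exists_getVert]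
    constructor
    · rintro ⟨k, rfl, hk⟩
      rcases hk.lt_or_eq with hk | rfl
      · exact ⟨k, by simp only [ZMod.val_natCast_of_lt hk]⟩
      · exact ⟨0, by simp⟩
    · rintro ⟨i, rfl⟩
      exact ⟨_, rfl, i.val_lt.le⟩
  · have h1 := hadj i
    have h2 := (hadj (i - 1)).symm
    rw [sub_add_cancel] at h2
    have hne : p.getVert (i + 1).val ≠ p.getVert (i - 1).val := by
      intro h
      have h' : i + 1 = i - 1 := hinj h
      have : ((2 : ℕ) : ZMod p.length) = (0 : ℕ) := by
        push_cast; linear_combination h'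
      rw [natCast_eq_natCast_of_lt (by omega) (by omega)] at this
      omega
    obtain ⟨x, y, hxy, hset⟩ := Set.ncard_eq_two.1 (hF ⟨_, h1⟩)
    have m1 : p.getVert (i + 1).val ∈ F.neighborSet (p.getVert i.val) := h1
    have m2 : p.getVert (i - 1).val ∈ F.neighborSet (p.getVert i.val) := h2
    have m3 : w ∈ F.neighborSet (p.getVert i.val) := hw
    rw [hset] at m1 m2 m3
    simp only [Set.mem_insert_iff, Set.mem_singleton_iff] at m1 m2 m3
    simp only
    grind

/-- The colors along an odd cycle whose first four vertices carry the word `b b b̄ b̄`. -/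
def oddCycleColor (b : Bool) (j : ℕ) : ZMod 7 :=
  if j = 0 then (if b then 6 else 2)
  else if j = 1 then 4
  else if j = 2 then (if b then 2 else 6)
  else if Even j then (if b then 3 else 5)
  else (if b then 5 else 3)

theorem oddCycleColor_of_three_le {b : Bool} {j : ℕ} (hj : 3 ≤ j) :
    oddCycleColor b j = if Even j then (if b then 3 else 5) else (if b then 5 else 3) := by
  simp [oddCycleColor, show j ≠ 0 by omega, show j ≠ 1 by omega, show j ≠ 2 by omega]

theorem exists_odd_cycle_coloring {n : ℕ} (hodd : Odd n) (hn : 7 ≤ n) {w : ZMod n → Bool}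
    {k : ZMod n} (hw : HasWindow w k) :
    ∃ h : ZMod n → ZMod 7, ∀ i, Far (h i) (h (i + 1)) ∧ Far (h i) (matchingColor (w i)) ∧
      Far (h i) (matchingColor (w (i + 1))) := by
  have : NeZero n := ⟨by omega⟩
  obtain ⟨l, b, h0, h1, h2, h3⟩ : ∃ l b, w l = b ∧ w (l + 1) = b ∧ w (l + 2) = !b ∧
      w (l + 3) = !b := by
    obtain ⟨h5, h3, h4⟩ := hw
    by_cases hbc : w (k + 1) = w (k + 2)
    · refine ⟨k + 1, w (k + 1), rfl, ?_, ?_, ?_⟩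
      · rw [hbc]; congr 1; ring
      · rw [← h3]; congr 1; ring
      · rw [hbc, ← h4]; congr 1; ring
    · by_cases hab : w k = w (k + 1)
      · refine ⟨k, w k, rfl, hab.symm, ?_, ?_⟩
        · revert hbc; rw [hab]; generalize w (k + 1) = A, w (k + 2) = B; revert A B; decide
        · rw [h3, hab]
      · have hac : w (k + 2) = w k := by
          revert hbc hab
          generalize w (k + 1) = A, w (k + 2) = B, w k = C; revert A B C; decide
        refine ⟨k + 2, w (k + 2), rfl, ?_, ?_, ?_⟩
        · rw [show k + 2 + 1 = k + 3 by ring, h3]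
          revert hbc; generalize w (k + 1) = A, w (k + 2) = B; revert A B; decide
        · rw [← h4]; congr 1; ring
        · rw [hac, ← h5]; congr 1; ring
  have hval (i : ZMod n) (j : ℕ) (hj : (i - l).val = j) : i = l + (j : ZMod n) := by
    rw [← hj, ZMod.natCast_zmod_val]; ring
  refine ⟨fun i => oddCycleColor b (i - l).val, fun i => ?_⟩
  have hstep := ZMod.val_add_one_cases (i - l)
  rw [show i - l + 1 = i + 1 - l by ring] at hstep
  have hlt := (i - l).val_lt
  simp only
  generalize hj' : (i + 1 - l).val = j' at *
  generalize hj : (i - l).val = j at *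
  have e := hval i j hj
  clear hj hj' hval hw
  rcases Nat.lt_or_ge j 3 with hj3 | hj3
  · obtain rfl : j' = j + 1 := by omega
    interval_cases j <;> subst e
    · simp only [Nat.cast_zero, add_zero, h0, h1]
      clear h0 h1 h2 h3; revert b; decide
    · rw [show l + ((1 : ℕ) : ZMod n) + 1 = l + 2 by push_cast; ring]
      simp only [Nat.cast_one, h1, h2]
      clear h0 h1 h2 h3; revert b; decide
    · rw [show l + ((2 : ℕ) : ZMod n) + 1 = l + 3 by push_cast; ring]
      simp only [Nat.cast_ofNat, h2, h3]
      clear h0 h1 h2 h3; revert b; decide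
  · rw [oddCycleColor_of_three_le hj3]
    refine ⟨?_, ?_⟩
    · rcases hstep with rfl | ⟨hjn, rfl⟩
      · rw [oddCycleColor_of_three_le (by omega)]
        by_cases hev : Even j
        · have : ¬ Even (j + 1) := by simpa [Nat.even_add_one] using hev
          simp only [hev, this, if_true, if_false]
          clear h0 h1 h2 h3; revert b; decide
        · have : Even (j + 1) := by simpa [Nat.even_add_one] using hev
          simp only [hev, this, if_true, if_false]
          clear h0 h1 h2 h3; revert b; decide
      · have hev : Even j := by
          rw [← hjn] at hodd
          by_contra h
          exact (Nat.not_even_iff_odd.2 hodd) (Nat.even_add_one.2 h)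
        simp only [hev, if_true]
        clear h0 h1 h2 h3; revert b; decide
    · generalize w i = A, w (i + 1) = B
      clear h0 h1 h2 h3
      by_cases hev : Even j <;> simp only [hev, if_true, if_false] <;> revert A B b <;> decide

theorem exists_even_cycle_coloring {n : ℕ} (heven : Even n) (w : ZMod n → Bool) :
    ∃ h : ZMod n → ZMod 7, ∀ i, Far (h i) (h (i + 1)) ∧ Far (h i) (matchingColor (w i)) ∧
      Far (h i) (matchingColor (w (i + 1))) := by
  refine ⟨fun i => if ZMod.castHom heven.two_dvd (ZMod 2) i = 0 then 3 else 5, fun i => ?_⟩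
  simp only [map_add, map_one]
  generalize ZMod.castHom heven.two_dvd (ZMod 2) i = x, w i = A, w (i + 1) = B
  revert x A B
  decide

/-- A disjoint union of cycles of length other than 3 and 5, together with an involution `σ` on the
vertices, has a coloring in which each vertex also carries one of the colors 0 and 1, constant on
the orbits of `σ`. -/
theorem SimpleGraph.IsCycles.exists_coloring {W : Type*} [Finite W] {F : SimpleGraph W}
    (hF : F.IsCycles) (h3 : ∀ a b c, F.Adj a b → F.Adj b c → ¬ F.Adj c a)
    (h5 : ∀ a b c d e, F.Adj a b → F.Adj b c → F.Adj c d → F.Adj d e → ¬ F.Adj e a)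
    {σ : W → W} (hσ : ∀ v, σ (σ v) = v) :
    ∃ (m : W → Bool) (g : Sym2 W → ZMod 7), (∀ v, m (σ v) = m v) ∧
      (∀ v u w, F.Adj v u → F.Adj v w → u ≠ w → Far (g s(v, u)) (g s(v, w))) ∧
      ∀ v u, F.Adj v u → Far (g s(v, u)) (matchingColor (m v)) := by
  classical
  let ι := {C : F.ConnectedComponent // ∃ v u, F.Adj v u ∧ C = F.connectedComponentMk v}
  have hpar (C : ι) : ∃ n, 3 ≤ n ∧ ∃ f : ZMod n → W, Function.Injective f ∧
      (∀ i, F.Adj (f i) (f (i + 1))) ∧ (∀ w, F.connectedComponentMk w = C.1 ↔ ∃ i, w = f i) ∧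
      ∀ i w, F.Adj (f i) w → w = f (i + 1) ∨ w = f (i - 1) := by
    obtain ⟨C, v, u, huv, rfl⟩ := C
    exact hF.exists_parametrization huv
  choose n hn3 f finj fadj fcomp fnbr using hpar
  have hdisj (C D : ι) (x y) (h : f C x = f D y) : C = D := by
    apply Subtype.ext
    rw [← (fcomp C _).2 ⟨x, rfl⟩, ← (fcomp D _).2 ⟨y, rfl⟩, h]
  have hn7 (C : ι) (hC : Odd (n C)) : 7 ≤ n C := by
    have := hn3 C
    by_contra! hlt
    have : n C = 3 ∨ n C = 5 := by obtain ⟨t, ht⟩ := hC; omega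
    have hadj (j : ZMod (n C)) := fadj C j
    rcases this with h | h
    · have e : ((3 : ℕ) : ZMod (n C)) = 0 := (congrArg Nat.cast h.symm).trans (ZMod.natCast_self _)
      have h' := hadj (0 + 1 + 1)
      rw [show (0 + 1 + 1 + 1 : ZMod (n C)) = 0 by push_cast at e; linear_combination e] at h'
      exact h3 _ _ _ (hadj 0) (hadj (0 + 1)) h'
    · have e : ((5 : ℕ) : ZMod (n C)) = 0 := (congrArg Nat.cast h.symm).trans (ZMod.natCast_self _)
      have h' := hadj (0 + 1 + 1 + 1 + 1)
      rw [show (0 + 1 + 1 + 1 + 1 + 1 : ZMod (n C)) = 0 by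
        push_cast at e; linear_combination e] at h'
      exact h5 _ _ _ _ _ (hadj 0) (hadj (0 + 1)) (hadj _) (hadj _) h'
  obtain ⟨m, hm, hwin⟩ := exists_invariant_hasWindow hσ (ι := {C : ι // Odd (n C)})
    (n := fun C => n C.1) (fun C => C.2) (fun C => hn7 _ C.2) (fun C => f C.1)
    (fun C => finj C.1) (fun C D x y h => Subtype.ext (hdisj _ _ _ _ h))
  have hcol (C : ι) : ∃ h : ZMod (n C) → ZMod 7, ∀ i, Far (h i) (h (i + 1)) ∧
      Far (h i) (matchingColor (m (f C i))) ∧ Far (h i) (matchingColor (m (f C (i + 1)))) := by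
    rcases Nat.even_or_odd (n C) with he | ho
    · exact exists_even_cycle_coloring he (m ∘ f C)
    · obtain ⟨k, hk⟩ := hwin ⟨C, ho⟩
      exact exists_odd_cycle_coloring ho (hn7 _ ho) hk
  choose h hh using hcol
  let E : (Σ C : ι, ZMod (n C)) → Sym2 W := fun x => s(f x.1 x.2, f x.1 (x.2 + 1))
  have hE : Function.Injective E := by
    rintro ⟨C, i⟩ ⟨D, j⟩ hij
    obtain rfl : C = D := by
      rcases Sym2.eq_iff.1 hij with ⟨h1, -⟩ | ⟨h1, -⟩
      · exact hdisj _ _ _ _ h1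
      · exact hdisj _ _ _ _ h1
    rcases Sym2.eq_iff.1 hij with ⟨h1, -⟩ | ⟨h1, h2⟩
    · have h1 : i = j := finj C h1
      rw [h1]
    · exfalso
      have h1 := finj C h1
      have h2 := finj C h2
      have : ((2 : ℕ) : ZMod (n C)) = (0 : ℕ) := by
        simp only at h1 h2
        push_cast; linear_combination h2 - h1
      have h3 := hn3 C
      rw [natCast_eq_natCast_of_lt (by omega) (by omega)] at this
      omega
  let g : Sym2 W → ZMod 7 := Function.extend E (fun x => h x.1 x.2) 0
  have hg (C : ι) (i) : g s(f C i, f C (i + 1)) = h C i :=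
    hE.extend_apply (fun x => h x.1 x.2) 0 ⟨C, i⟩
  have hg' (C : ι) (i) : g s(f C i, f C (i - 1)) = h C (i - 1) := by
    have := hg C (i - 1)
    rwa [sub_add_cancel, Sym2.eq_swap] at this
  have hform (v u) (huv : F.Adj v u) : ∃ (C : ι) (i : _), v = f C i :=
    ⟨⟨_, v, u, huv, rfl⟩, (fcomp _ v).1 rfl⟩
  have hstep (C : ι) (i) : Far (h C i) (h C (i - 1)) := by
    have := (hh C (i - 1)).1
    rw [sub_add_cancel] at this
    exact this.symm
  refine ⟨m, g, hm, fun v u w hu hw huw => ?_, fun v u hu => ?_⟩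
  · obtain ⟨C, i, rfl⟩ := hform v u hu
    rcases fnbr C i u hu with rfl | rfl <;> rcases fnbr C i w hw with rfl | rfl
    · exact absurd rfl huw
    · rw [hg, hg']; exact hstep C i
    · rw [hg, hg']; exact (hstep C i).symm
    · exact absurd rfl huw
  · obtain ⟨C, i, rfl⟩ := hform v u hu
    rcases fnbr C i u hu with rfl | rfl
    · rw [hg]; exact (hh C i).2.1
    · rw [hg']
      have := (hh C (i - 1)).2.2
      rwa [sub_add_cancel] at this

/-- `G` has a coloring of its edges with colors in `ZMod 7` such that adjacent edges get colors at
circular distance at least two. -/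
def SimpleGraph.HasFarColoring {V : Type*} (G : SimpleGraph V) : Prop :=
  ∃ g : Sym2 V → ZMod 7, ∀ v u w, G.Adj v u → G.Adj v w → u ≠ w → Far (g s(v, u)) (g s(v, w))

/-- Two copies of `F`, where the two copies of each vertex of degree one are joined. -/
def SimpleGraph.doubleClosure {V : Type*} (F : SimpleGraph V) : SimpleGraph (V × Bool) where
  Adj a b := (a.2 = b.2 ∧ F.Adj a.1 b.1) ∨ (a.2 ≠ b.2 ∧ a.1 = b.1 ∧ (F.neighborSet a.1).ncard = 1)
  symm := ⟨by
    rintro a b (⟨h1, h2⟩ | ⟨h1, h2, h3⟩)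
    · exact .inl ⟨h1.symm, h2.symm⟩
    · exact .inr ⟨h1.symm, h2.symm, h2 ▸ h3⟩⟩
  loopless := ⟨by
    rintro a (⟨h1, h2⟩ | ⟨h1, h2, h3⟩)
    · exact F.loopless.irrefl _ h2
    · exact h1 rfl⟩

theorem SimpleGraph.isCycles_doubleClosure {V : Type*} [Finite V] {F : SimpleGraph V}
    (h : ∀ v, (F.neighborSet v).ncard ≤ 2) : F.doubleClosure.IsCycles := by
  rintro ⟨v, i⟩ hne
  have himg : ((fun w => (w, i)) '' F.neighborSet v).ncard = (F.neighborSet v).ncard :=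
    Set.ncard_image_of_injective _ fun a b h => (Prod.ext_iff.1 h).1
  by_cases h1 : (F.neighborSet v).ncard = 1
  · have : F.doubleClosure.neighborSet (v, i) =
        insert (v, !i) ((fun w => (w, i)) '' F.neighborSet v) := by
      ext ⟨w, j⟩
      simp only [mem_neighborSet, doubleClosure, h1, Set.mem_insert_iff, Set.mem_image,
        Prod.mk.injEq]
      cases i <;> cases j <;> simp [eq_comm]
    rw [this, Set.ncard_insert_of_notMem (by simp), himg, h1]
  · have : F.doubleClosure.neighborSet (v, i) = (fun w => (w, i)) '' F.neighborSet v := by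
      ext ⟨w, j⟩
      simp only [mem_neighborSet, doubleClosure, h1, Set.mem_image,
        Prod.mk.injEq]
      cases i <;> cases j <;> simp
    rw [this] at hne ⊢
    have hpos := (Set.ncard_pos (Set.toFinite _)).2 hne
    have := h v
    omega

theorem SimpleGraph.hasFarColoring_of_matching {V : Type*} [Finite V] {G : SimpleGraph V}
    (hdeg : ∀ v, (G.neighborSet v).ncard ≤ 3)
    (h3 : ∀ a b c, G.Adj a b → G.Adj b c → ¬ G.Adj c a)
    (h5 : ∀ a b c d e, G.Adj a b → G.Adj b c → G.Adj c d → G.Adj d e → ¬ G.Adj e a)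
    {σ : V → V} (hσ : ∀ v, σ (σ v) = v) (hadj : ∀ v, σ v ≠ v → G.Adj v (σ v))
    (hcover : ∀ v, (G.neighborSet v).ncard = 3 → σ v ≠ v) : G.HasFarColoring := by
  classical
  have hswap (u v) : σ u = v ↔ σ v = u :=
    ⟨fun h => h ▸ hσ u, fun h => h ▸ hσ v⟩
  let F : SimpleGraph V :=
    { Adj := fun u v => G.Adj u v ∧ σ u ≠ v
      symm := ⟨fun u v h => ⟨h.1.symm, fun h' => h.2 ((hswap _ _).1 h')⟩⟩
      loopless := ⟨fun u h => G.loopless.irrefl u h.1⟩ }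
  have hFdeg (v) : (F.neighborSet v).ncard ≤ 2 := by
    by_cases hv : σ v = v
    · have h1 : (F.neighborSet v).ncard ≤ (G.neighborSet v).ncard :=
        Set.ncard_le_ncard fun w hw => hw.1
      have h2 := hdeg v
      have h3 : (G.neighborSet v).ncard ≠ 3 := fun h => hcover v h hv
      omega
    · have h1 : (F.neighborSet v).ncard < (G.neighborSet v).ncard :=
        Set.ncard_lt_ncard ⟨fun w hw => hw.1, fun h => (h (hadj v hv)).2 rfl⟩
      have h2 := hdeg v
      omega
  have hstep (a b : V × Bool) (h : F.doubleClosure.Adj a b) :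
      (b.2 = a.2 ∧ G.Adj a.1 b.1) ∨ (b.2 = !a.2 ∧ b.1 = a.1) := by
    rcases h with ⟨h1, h2⟩ | ⟨h1, h2, -⟩
    · exact .inl ⟨h1.symm, h2.1⟩
    · exact .inr ⟨by cases h : a.2 <;> cases h' : b.2 <;> simp_all, h2.symm⟩
  have hirr (a) : ¬ G.Adj a a := G.loopless.irrefl a
  obtain ⟨m, g, hm, hgg, hgm⟩ := (isCycles_doubleClosure hFdeg).exists_coloring
    (σ := fun a => (σ a.1, a.2))
    (by
      rintro ⟨a, i⟩ ⟨b, j⟩ ⟨c, k⟩ hab hbc hca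
      rcases hstep _ _ hab with ⟨p1, q1⟩ | ⟨p1, q1⟩ <;>
      rcases hstep _ _ hbc with ⟨p2, q2⟩ | ⟨p2, q2⟩ <;>
      rcases hstep _ _ hca with ⟨p3, q3⟩ | ⟨p3, q3⟩ <;>
      dsimp only at * <;> subst p1 p2 <;> first
      | (exfalso; simp at p3; done)
      | (clear p3; subst_vars; first | exact hirr _ ‹_› | exact h3 _ _ _ q1 q2 q3))
    (by
      rintro ⟨a, i⟩ ⟨b, j⟩ ⟨c, k⟩ ⟨d, l⟩ ⟨e, n⟩ hab hbc hcd hde hea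
      rcases hstep _ _ hab with ⟨p1, q1⟩ | ⟨p1, q1⟩ <;>
      rcases hstep _ _ hbc with ⟨p2, q2⟩ | ⟨p2, q2⟩ <;>
      rcases hstep _ _ hcd with ⟨p3, q3⟩ | ⟨p3, q3⟩ <;>
      rcases hstep _ _ hde with ⟨p4, q4⟩ | ⟨p4, q4⟩ <;>
      rcases hstep _ _ hea with ⟨p5, q5⟩ | ⟨p5, q5⟩ <;>
      dsimp only at * <;> subst p1 p2 p3 p4 <;> first
      | (exfalso; simp at p5; done)
      | (clear p5; subst_vars; first
        | exact hirr _ ‹_›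
        | exact h5 _ _ _ _ _ q1 q2 q3 q4 q5
        | exact h3 _ _ _ q1 q2 q3
        | exact h3 _ _ _ q1 q2 q4
        | exact h3 _ _ _ q1 q2 q5
        | exact h3 _ _ _ q1 q3 q4
        | exact h3 _ _ _ q1 q3 q5
        | exact h3 _ _ _ q1 q4 q5
        | exact h3 _ _ _ q2 q3 q4
        | exact h3 _ _ _ q2 q3 q5
        | exact h3 _ _ _ q2 q4 q5
        | exact h3 _ _ _ q3 q4 q5))
    (fun a => by simp [hσ])
  have hF (u v) (h : G.Adj u v) (h' : σ u ≠ v) : F.doubleClosure.Adj (u, false) (v, false) :=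
    .inl ⟨rfl, h, h'⟩
  have hm' (u v) (h : σ u = v) : m (v, false) = m (u, false) := h ▸ hm (u, false)
  refine ⟨Sym2.lift ⟨fun u v => if σ u = v then matchingColor (m (u, false)) else
    g s((u, false), (v, false)), fun u v => ?_⟩, fun v u w hu hw huw => ?_⟩
  · dsimp only
    by_cases h : σ u = v
    · rw [if_pos h, if_pos ((hswap _ _).1 h), hm' u v h]
    · rw [if_neg h, if_neg (fun h' => h ((hswap _ _).1 h')), Sym2.eq_swap]
  · simp only [Sym2.lift_mk]
    by_cases h1 : σ v = u <;> by_cases h2 : σ v = w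
    · exact absurd (h1.symm.trans h2) huw
    · rw [if_pos h1, if_neg h2]
      exact (hgm _ _ (hF _ _ hw h2)).symm
    · rw [if_neg h1, if_pos h2]
      exact hgm _ _ (hF _ _ hu h1)
    · rw [if_neg h1, if_neg h2]
      exact hgg _ _ _ (hF _ _ hu h1) (hF _ _ hw h2) (by simpa using huw)

namespace SimpleGraph

open Finset in
theorem even_sum_sum_adj {V : Type*} (G : SimpleGraph V) [DecidableRel G.Adj] (K : Finset V) :
    Even (∑ x ∈ K, ∑ y ∈ K, if G.Adj x y then 1 else 0) := by
  classical
  induction K using Finset.induction_on with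
  | empty => simp
  | insert a K ha ih =>
    have hcomm : ∑ x ∈ K, (if G.Adj x a then 1 else 0) = ∑ x ∈ K, if G.Adj a x then 1 else 0 :=
      sum_congr rfl fun x _ => by simp only [G.adj_comm]
    simp only [sum_insert ha, sum_add_distrib, hcomm, G.irrefl, if_false, zero_add]
    rw [← add_assoc]
    exact (Even.add_self _).add ih

open Finset in
/-- Disjoint odd sets of vertices of degree three in a subcubic graph are at most as numerous as
the vertices of a set separating them, if every cut that consists of a single edge is given by a
vertex of degree one. -/
theorem card_le_card_of_odd_of_degree_eq_three {V ι : Type*} [Fintype V] [DecidableEq V]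
    {G : SimpleGraph V} [DecidableRel G.Adj] (hdeg : ∀ v, G.degree v ≤ 3)
    (hcut : ∀ (A : Set V) (a b : V), a ∈ A → b ∉ A → G.Adj a b →
      (∀ x ∈ A, ∀ y ∉ A, G.Adj x y → x = a ∧ y = b) → G.degree a = 1 ∨ G.degree b = 1)
    {T : Finset ι} {K : ι → Finset V} {S : Finset V}
    (hdisj : (T : Set ι).PairwiseDisjoint K) (hodd : ∀ i ∈ T, Odd #(K i))
    (hthree : ∀ i ∈ T, ∀ x ∈ K i, G.degree x = 3)
    (hsep : ∀ i ∈ T, ∀ x ∈ K i, ∀ y ∉ K i, G.Adj x y → y ∈ S)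
    (hS : ∀ i ∈ T, Disjoint (K i) S) : #T ≤ #S := by
  let w (s : V) : ℕ := if G.degree s = 1 then 3 else 1
  have hw (s) : 1 ≤ w s := by
    simp only [w]
    split_ifs <;> simp
  have hdegree (s : V) : ∑ x, (if G.Adj s x then 1 else 0) = G.degree s := by
    rw [← card_filter, ← card_neighborFinset_eq_degree]
    congr 1
    ext
    simp
  have hlower (i) (hi : i ∈ T) : 3 ≤ ∑ x ∈ K i, ∑ s ∈ S, if G.Adj x s then w s else 0 := by
    have hsplit : ∑ x ∈ K i, ∑ y ∈ K i, (if G.Adj x y then 1 else 0) +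
        ∑ x ∈ K i, ∑ s ∈ S, (if G.Adj x s then 1 else 0) = 3 * #(K i) := by
      rw [← sum_add_distrib, mul_comm, ← smul_eq_mul, ← sum_const]
      refine sum_congr rfl fun x hx => ?_
      rw [← sum_union (hS i hi), ← hthree i hi x hx, ← hdegree]
      refine sum_subset (subset_univ _) fun y _ hy => if_neg fun h => hy ?_
      by_cases hyK : y ∈ K i
      · exact mem_union_left _ hyK
      · exact mem_union_right _ (hsep i hi x hx y hyK h)
    have hle : ∑ x ∈ K i, ∑ s ∈ S, (if G.Adj x s then 1 else 0) ≤
        ∑ x ∈ K i, ∑ s ∈ S, if G.Adj x s then w s else 0 :=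
      sum_le_sum fun x _ => sum_le_sum fun s _ => by split_ifs <;> simp [hw]
    obtain ⟨k, hk⟩ := G.even_sum_sum_adj (K i)
    obtain ⟨l, hl⟩ := hodd i hi
    by_cases h1 : ∑ x ∈ K i, ∑ s ∈ S, (if G.Adj x s then 1 else 0) = 1
    · rw [← sum_product'] at h1 ⊢
      rw [← card_filter, card_eq_one] at h1
      obtain ⟨⟨a, b⟩, hab⟩ := h1
      have hmem (x y) : ((x ∈ K i ∧ y ∈ S) ∧ G.Adj x y) ↔ x = a ∧ y = b := by
        have := congrArg ((x, y) ∈ ·) hab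
        simpa using this
      obtain ⟨⟨ha, hb⟩, hadj⟩ := (hmem a b).2 ⟨rfl, rfl⟩
      have hleaf : G.degree b = 1 := by
        refine (hcut (K i) a b ha (fun hb' => Finset.disjoint_left.1 (hS i hi) hb' hb) hadj
          fun x hx y hy h => (hmem x y).1 ⟨⟨hx, hsep i hi x hx y hy h⟩, h⟩).resolve_left ?_
        rw [hthree i hi a ha]
        simp
      calc 3 = if G.Adj a b then w b else 0 := by simp [hadj, w, hleaf]
        _ ≤ _ := single_le_sum (f := fun p : V × V => if G.Adj p.1 p.2 then w p.2 else 0)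
          (fun _ _ => Nat.zero_le _) (mk_mem_product ha hb)
    · omega
  have hupper : ∑ x, ∑ s ∈ S, (if G.Adj x s then w s else 0) ≤ #S * 3 := by
    rw [sum_comm]
    refine sum_le_card_nsmul _ _ _ fun s _ => ?_
    have : ∑ x, (if G.Adj x s then w s else 0) = G.degree s * w s := by
      rw [← hdegree, sum_mul]
      exact sum_congr rfl fun x _ => by simp [G.adj_comm]
    rw [this]
    have := hdeg s
    simp only [w]
    split_ifs <;> omega
  have hsum : #T * 3 ≤ ∑ x, ∑ s ∈ S, if G.Adj x s then w s else 0 := by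
    calc #T * 3 ≤ ∑ i ∈ T, ∑ x ∈ K i, ∑ s ∈ S, (if G.Adj x s then w s else 0) :=
        card_nsmul_le_sum _ _ _ hlower
      _ = ∑ x ∈ T.biUnion K, ∑ s ∈ S, (if G.Adj x s then w s else 0) := (sum_biUnion hdisj).symm
      _ ≤ _ := sum_le_sum_of_subset (subset_univ _)
  omega

theorem exists_involution_of_even_card {V : Type*} [Finite V] {G : SimpleGraph V}
    (heven : Even (Nat.card V)) (hdeg : ∀ v, (G.neighborSet v).ncard ≤ 3)
    (hcut : ∀ (A : Set V) (a b : V), a ∈ A → b ∉ A → G.Adj a b →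
      (∀ x ∈ A, ∀ y ∉ A, G.Adj x y → x = a ∧ y = b) →
      (G.neighborSet a).ncard = 1 ∨ (G.neighborSet b).ncard = 1) :
    ∃ σ : V → V, (∀ v, σ (σ v) = v) ∧ (∀ v, σ v ≠ v → G.Adj v (σ v)) ∧
      ∀ v, (G.neighborSet v).ncard = 3 → σ v ≠ v := by
  classical
  have := Fintype.ofFinite V
  have hdegree (v) : (G.neighborSet v).ncard = G.degree v := by
    rw [Set.ncard_eq_toFinset_card', ← card_neighborFinset_eq_degree, neighborFinset]
  simp only [hdegree] at hdeg hcut ⊢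
  let H : SimpleGraph V :=
    { Adj := fun u v => G.Adj u v ∨ (u ≠ v ∧ G.degree u ≠ 3 ∧ G.degree v ≠ 3)
      symm := ⟨fun u v h => h.imp (·.symm) fun h => ⟨h.1.symm, h.2.2, h.2.1⟩⟩
      loopless := ⟨fun u h => h.elim G.irrefl fun h => h.1 rfl⟩ }
  suffices h : ∃ M : Subgraph H, M.IsPerfectMatching by
    obtain ⟨M, hM⟩ := h
    choose p hp hp' using Subgraph.isPerfectMatching_iff.1 hM
    have hpp (v) : p (p v) = v := (hp' _ _ (hp v).symm).symm
    refine ⟨fun v => if G.Adj v (p v) then p v else v, fun v => ?_, fun v hv => ?_, fun v hv => ?_⟩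
    · by_cases h : G.Adj v (p v)
      · simp [h, hpp, h.symm]
      · simp [h]
    · by_cases h : G.Adj v (p v)
      · simp [h]
      · simp [h] at hv
    · have h : G.Adj v (p v) := (hp v).adj_sub.resolve_right fun h => h.2.1 hv
      simp [h, h.ne.symm]
  refine tutte.2 fun u hu => ?_
  rw [IsTutteViolator] at hu
  set D := ((⊤ : H.Subgraph).deleteVerts u) with hD
  have hverts (v) : v ∈ D.verts ↔ v ∉ u := by simp [hD]
  have hDadj (x y : D.verts) (h : H.Adj x y) : D.coe.Adj x y := by
    simp [hD, h, (hverts _).1 x.2, (hverts _).1 y.2]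
  let K (c : D.coe.ConnectedComponent) : Finset V := (Subtype.val '' c.supp).toFinset
  have hK (c) (v) : v ∈ K c ↔ ∃ h : v ∈ D.verts, ⟨v, h⟩ ∈ c.supp := by simp [K]
  let O := D.coe.oddComponents.toFinset
  have hO (c) : c ∈ O ↔ Odd c.supp.ncard := by simp [O]
  let T := O.filter fun c => ∀ x ∈ K c, G.degree x = 3
  have hTO : O.card ≤ T.card + 1 := by
    have : (O \ T).card ≤ 1 := by
      refine Finset.card_le_one.2 fun c hc d hd => ?_
      have key (c) (hc : c ∈ O \ T) : ∃ x : D.verts, x ∈ c.supp ∧ G.degree x ≠ 3 := by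
        simp only [T, Finset.mem_sdiff, Finset.mem_filter, not_and, not_forall] at hc
        obtain ⟨x, hx, hx3⟩ := hc.2 hc.1
        obtain ⟨h, h'⟩ := (hK _ _).1 hx
        exact ⟨⟨x, h⟩, h', hx3⟩
      obtain ⟨x, hxc, hx⟩ := key c hc
      obtain ⟨y, hyd, hy⟩ := key d hd
      by_cases hxy : x = y
      · exact ConnectedComponent.eq_of_common_vertex hxc (hxy ▸ hyd)
      · refine ConnectedComponent.eq_of_common_vertex hxc
          ((d.mem_supp_congr_adj (hDadj x y (.inr ⟨?_, hx, hy⟩))).2 hyd)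
        exact fun h => hxy (Subtype.ext h)
    have := Finset.le_card_sdiff T O
    omega
  have hT : T.card ≤ u.toFinset.card := by
    refine card_le_card_of_odd_of_degree_eq_three hdeg hcut (K := K) ?_ ?_ ?_ ?_ ?_
    · intro c _ d _ hcd
      refine Finset.disjoint_left.2 fun x hx hx' => hcd ?_
      obtain ⟨h, h'⟩ := (hK _ _).1 hx
      obtain ⟨_, h''⟩ := (hK _ _).1 hx'
      exact ConnectedComponent.eq_of_common_vertex h' h''
    · intro c hc
      have := (hO c).1 (Finset.mem_filter.1 hc).1
      rwa [← Set.ncard_image_of_injective _ Subtype.val_injective, Set.ncard_eq_toFinset_card']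
        at this
    · exact fun c hc => (Finset.mem_filter.1 hc).2
    · intro c hc x hx y hy hxy
      by_contra h
      obtain ⟨hx, hxc⟩ := (hK _ _).1 hx
      have hy' := (hverts y).2 (by simpa using h)
      exact hy ((hK _ _).2 ⟨hy', (c.mem_supp_congr_adj (hDadj ⟨x, hx⟩ ⟨y, hy'⟩ (.inl hxy))).1 hxc⟩)
    · intro c _
      refine Finset.disjoint_left.2 fun x hx hx' => ?_
      obtain ⟨h, -⟩ := (hK _ _).1 hx
      exact (hverts x).1 h (by simpa using hx')
  have hOcard : D.coe.oddComponents.ncard = O.card := Set.ncard_eq_toFinset_card' _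
  have hucard : u.ncard = u.toFinset.card := Set.ncard_eq_toFinset_card' _
  have hparity := D.coe.odd_ncard_oddComponents
  have hcard : Nat.card D.verts + u.ncard = Nat.card V := by
    rw [Nat.card_coe_set_eq, show D.verts = uᶜ by ext v; simp [hverts], add_comm,
      Set.ncard_add_ncard_compl]
  rw [Nat.odd_iff, Nat.odd_iff] at hparity
  rw [Nat.even_iff] at heven
  omega

theorem exists_involution_of_cut {V : Type*} [Finite V] {G : SimpleGraph V}
    (hdeg : ∀ v, (G.neighborSet v).ncard ≤ 3)
    (hcut : ∀ (A : Set V) (a b : V), a ∈ A → b ∉ A → G.Adj a b →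
      (∀ x ∈ A, ∀ y ∉ A, G.Adj x y → x = a ∧ y = b) →
      (G.neighborSet a).ncard = 1 ∨ (G.neighborSet b).ncard = 1) :
    ∃ σ : V → V, (∀ v, σ (σ v) = v) ∧ (∀ v, σ v ≠ v → G.Adj v (σ v)) ∧
      ∀ v, (G.neighborSet v).ncard = 3 → σ v ≠ v := by
  let D : SimpleGraph (V × Bool) :=
    { Adj := fun a b => a.2 = b.2 ∧ G.Adj a.1 b.1
      symm := ⟨fun a b h => ⟨h.1.symm, h.2.symm⟩⟩
      loopless := ⟨fun a h => G.irrefl h.2⟩ }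
  have hncard (a : V × Bool) : (D.neighborSet a).ncard = (G.neighborSet a.1).ncard := by
    have : D.neighborSet a = (fun w => (w, a.2)) '' G.neighborSet a.1 := by
      ext ⟨w, j⟩
      simp [D, and_comm]
    rw [this, Set.ncard_image_of_injective _ fun x y h => (Prod.ext_iff.1 h).1]
  obtain ⟨σ, hσ, hadj, hcover⟩ := exists_involution_of_even_card (G := D)
    (by simp [Nat.card_prod]) (by simpa [hncard] using fun a => hdeg a) (by
      rintro A ⟨a, i⟩ ⟨b, j⟩ ha hb ⟨rfl, hab⟩ huniq
      rw [hncard, hncard]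
      refine hcut {v | (v, i) ∈ A} a b ha hb hab fun x hx y hy hxy => ?_
      have := huniq (x, i) hx (y, i) hy ⟨rfl, hxy⟩
      simpa using this)
  have hsnd (a) : (σ a).2 = a.2 := by
    by_cases h : σ a = a
    · rw [h]
    · exact (hadj a h).1.symm
  have hfst (v) : ((σ (v, false)).1, false) = σ (v, false) := Prod.ext rfl (hsnd (v, false)).symm
  have hne (v) (h : σ (v, false) ≠ (v, false)) : (σ (v, false)).1 ≠ v :=
    fun h' => h (Prod.ext h' (hsnd _))
  refine ⟨fun v => (σ (v, false)).1, fun v => ?_, fun v hv => ?_, fun v hv => ?_⟩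
  · simp only [hfst, hσ]
  · exact (hadj (v, false) fun h => hv (by simp only [h])).2
  · exact hne v (hcover _ (by rw [hncard]; exact hv))

theorem HasFarColoring.of_cut {V : Type*} {G G₁ G₂ : SimpleGraph V} {A : Set V} {a b : V}
    (huniq : ∀ x ∈ A, ∀ y ∉ A, G.Adj x y → x = a ∧ y = b)
    (h₁ : ∀ x ∈ A, ∀ y, G.Adj x y → G₁.Adj x y) (h₂ : ∀ x ∉ A, ∀ y, G.Adj x y → G₂.Adj x y)
    (hG₁ : G₁.HasFarColoring) (hG₂ : G₂.HasFarColoring) : G.HasFarColoring := by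
  classical
  obtain ⟨g₁, hg₁⟩ := hG₁
  obtain ⟨g₂, hg₂⟩ := hG₂
  set t := g₁ s(a, b) - g₂ s(a, b) with ht
  let g (e : Sym2 V) : ZMod 7 := if ∃ x ∈ e, x ∈ A then g₁ e else g₂ e + t
  have hgmem (v u) (hv : v ∈ A) : g s(v, u) = g₁ s(v, u) :=
    if_pos ⟨v, Sym2.mem_mk_left _ _, hv⟩
  have hgnot (v u) (hv : v ∉ A) (h : G.Adj v u) : g s(v, u) = g₂ s(v, u) + t := by
    by_cases hu : u ∈ A
    · obtain ⟨rfl, rfl⟩ := huniq u hu v hv h.symm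
      rw [Sym2.eq_swap, hgmem _ _ hu, ht]
      ring
    · refine if_neg ?_
      rintro ⟨x, hx, hxA⟩
      rcases Sym2.mem_iff.1 hx with rfl | rfl
      exacts [hv hxA, hu hxA]
  refine ⟨g, fun v u w hu hw huw => ?_⟩
  by_cases hv : v ∈ A
  · rw [hgmem v u hv, hgmem v w hv]
    exact hg₁ v u w (h₁ v hv u hu) (h₁ v hv w hw) huw
  · rw [hgnot v u hv hu, hgnot v w hv hw]
    have := hg₂ v u w (h₂ v hv u hu) (h₂ v hv w hw) huw
    rwa [Far, ← add_sub_add_right_eq_sub _ _ t] at this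

theorem hasFarColoring_of_ncard_neighborSet_le_three {V : Type*} [Finite V] (G : SimpleGraph V)
    (hdeg : ∀ v, (G.neighborSet v).ncard ≤ 3)
    (h3 : ∀ a b c, G.Adj a b → G.Adj b c → ¬ G.Adj c a)
    (h5 : ∀ a b c d e, G.Adj a b → G.Adj b c → G.Adj c d → G.Adj d e → ¬ G.Adj e a) :
    G.HasFarColoring := by
  induction G using WellFoundedLT.induction with
  | ind G ih =>
  by_cases hcut : ∀ (A : Set V) (a b : V), a ∈ A → b ∉ A → G.Adj a b →
      (∀ x ∈ A, ∀ y ∉ A, G.Adj x y → x = a ∧ y = b) →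
      (G.neighborSet a).ncard = 1 ∨ (G.neighborSet b).ncard = 1
  · obtain ⟨σ, hσ, hadj, hcover⟩ := exists_involution_of_cut hdeg hcut
    exact hasFarColoring_of_matching hdeg h3 h5 hσ hadj hcover
  push Not at hcut
  obtain ⟨A, a, b, ha, hb, hab, huniq, ha1, hb1⟩ := hcut
  have hother (x y : V) (h : G.Adj x y) (h1 : (G.neighborSet x).ncard ≠ 1) :
      ∃ z, G.Adj x z ∧ z ≠ y := by
    by_contra! hz
    refine h1 (Set.ncard_eq_one.2 ⟨y, Set.eq_singleton_iff_unique_mem.2 ⟨h, hz⟩⟩)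
  obtain ⟨c, hac, hcb⟩ := hother a b hab ha1
  obtain ⟨d, hbd, hda⟩ := hother b a hab.symm hb1
  have hc : c ∈ A := by_contra fun hc => hcb (huniq a ha c hc hac).2
  have hd : d ∉ A := fun hd => hda (huniq d hd b hb hbd.symm).1
  let part (B : Set V) : SimpleGraph V :=
    { Adj := fun x y => G.Adj x y ∧ (x ∈ B ∨ y ∈ B)
      symm := ⟨fun x y h => ⟨h.1.symm, h.2.symm⟩⟩
      loopless := ⟨fun x h => G.irrefl h.1⟩ }
  have hpart (B : Set V) (x y : V) (h : G.Adj x y) (hx : x ∉ B) (hy : y ∉ B) :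
      (part B).HasFarColoring := by
    refine ih _ ⟨fun _ _ h => h.1, fun hle => (hle x y h).2.elim hx hy⟩ (fun v => ?_) ?_ ?_
    · exact (Set.ncard_le_ncard fun w hw => hw.1).trans (hdeg v)
    · exact fun _ _ _ h1 h2 h3' => h3 _ _ _ h1.1 h2.1 h3'.1
    · exact fun _ _ _ _ _ h1 h2 h3' h4 h5' => h5 _ _ _ _ _ h1.1 h2.1 h3'.1 h4.1 h5'.1
  exact .of_cut (G₁ := part A) (G₂ := part Aᶜ) huniq (fun x hx y h => ⟨h, .inl hx⟩)
    (fun x hx y h => ⟨h, .inl hx⟩) (hpart A b d hbd hb hd)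
    (hpart Aᶜ a c hac (fun h => h ha) (fun h => h hc))

theorem not_adj_of_forall_isCycle_length_ne_three {V : Type*} {G : SimpleGraph V}
    (h : ∀ (v : V) (p : G.Walk v v), p.IsCycle → p.length ≠ 3) {a b c : V} (hab : G.Adj a b)
    (hbc : G.Adj b c) : ¬ G.Adj c a := by
  intro hca
  refine h a (.cons hab (.cons hbc (.cons hca .nil))) ?_ rfl
  have := hab.ne
  have := hbc.ne
  have := hca.ne
  simp only [Walk.isCycle_def, Walk.isTrail_def, Walk.edges_cons, Walk.edges_nil,
    Walk.support_cons, Walk.support_nil, List.tail_cons, List.nodup_cons, List.mem_cons,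
    Sym2.eq_iff, List.not_mem_nil, List.nodup_nil]
  grind

theorem not_adj_of_forall_isCycle_length_ne_five {V : Type*} {G : SimpleGraph V}
    (h : ∀ (v : V) (p : G.Walk v v), p.IsCycle → p.length ≠ 3 ∧ p.length ≠ 5) {a b c d e : V}
    (hab : G.Adj a b) (hbc : G.Adj b c) (hcd : G.Adj c d) (hde : G.Adj d e) : ¬ G.Adj e a := by
  intro hea
  have h3 {a b c : V} := not_adj_of_forall_isCycle_length_ne_three
    (fun v p hp => (h v p hp).1) (a := a) (b := b) (c := c)
  refine (h a (.cons hab (.cons hbc (.cons hcd (.cons hde (.cons hea .nil))))) ?_).2 rfl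
  have := hab.ne
  have := hbc.ne
  have := hcd.ne
  have := hde.ne
  have := hea.ne
  have hac : a ≠ c := by
    rintro rfl
    exact h3 hcd hde hea
  have hbd : b ≠ d := by
    rintro rfl
    exact h3 hea hab hde
  have hce : c ≠ e := by
    rintro rfl
    exact h3 hab hbc hea
  have had : a ≠ d := by
    rintro rfl
    exact h3 hab hbc hcd
  have hbe : b ≠ e := by
    rintro rfl
    exact h3 hbc hcd hde
  simp only [Walk.isCycle_def, Walk.isTrail_def, Walk.edges_cons, Walk.edges_nil,
    Walk.support_cons, Walk.support_nil, List.tail_cons, List.nodup_cons, List.mem_cons,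
    Sym2.eq_iff, List.not_mem_nil, List.nodup_nil]
  grind

end SimpleGraph

/-- Every finite simple subcubic graph with no cycle of length 3 and no cycle of
length 5 (i.e., with odd-girth at least 7) admits a (7,2)-edge-coloring. -/
theorem subcubic_odd_girth_seven_circ_edge_coloring
    {V : Type*} [Fintype V] (G : SimpleGraph V) [DecidableRel G.Adj]
    (hsubcubic : ∀ v : V, G.degree v ≤ 3)
    (hoddgirth : ∀ (v : V) (p : G.Walk v v), p.IsCycle → p.length ≠ 3 ∧ p.length ≠ 5) :
    ∃ c : G.edgeSet → ZMod 7, IsCircEdgeColoring72 G c := by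
  obtain ⟨g, hg⟩ := G.hasFarColoring_of_ncard_neighborSet_le_three
    (fun v => by
      rw [Set.ncard_eq_toFinset_card']
      exact hsubcubic v)
    (fun _ _ _ => SimpleGraph.not_adj_of_forall_isCycle_length_ne_three
      fun v p hp => (hoddgirth v p hp).1)
    (fun _ _ _ _ _ => SimpleGraph.not_adj_of_forall_isCycle_length_ne_five hoddgirth)
  refine ⟨fun e => g e, ?_⟩
  rintro ⟨e, he⟩ ⟨f, hf⟩ hef ⟨v, hve, hvf⟩
  obtain ⟨u, rfl⟩ := Sym2.mem_iff_exists.1 hve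
  obtain ⟨w, rfl⟩ := Sym2.mem_iff_exists.1 hvf
  have := hg v u w he hf fun h => hef (by simp [h])
  simpa [Far] using this
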